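/- Let b, σ : ℝ → ℝ be continuous, a : ℝ → ℝ continuously differentiable, κ(t) = ∫_0^t b(s) ds, G(t) = ∫_0^t e^{−κ(s)} ds, and Λ₀(T) = ∫_0^T [ e^{κ(v)} a(v) (∫_v^T e^{−κ(z)} dz) − (1/2) e^{2κ(v)} σ(v)² (∫_v^T e^{−κ(z)} dz)² ] dv. Let r₀ ∈ ℝ and suppose y : ℝ → ℝ satisfies Λ₀(t) = y(t) − r₀·G(t) for all t. Then a satisfies the calibration ODE: for every t, a'(t)·e^{2κ(t)} + 2·a(t)·b(t)·e^{2κ(t)} − e^{2κ(t)}·σ(t)² = d/dt [ e^{κ(t)} · d/dt ( e^{κ(t)} · d/dt ( y(t) − r₀·G(t) ) ) ]. -/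

import Mathlib

open intervalIntegral in
/-- Convolution-type quadratic integral with kernel increments `G T - G v`, expanded in powers of
`G T`. -/
theorem integral_mul_sub_sub_half_mul_sub_sq {p q G : ℝ → ℝ} (hp : Continuous p)
    (hq : Continuous q) (hG : Continuous G) (c T : ℝ) :
    ∫ v in c..T, (p v * (G T - G v) - (1 / 2) * q v * (G T - G v) ^ 2)
      = G T * (∫ v in c..T, p v) - (∫ v in c..T, p v * G v)
        - (1 / 2) * (G T ^ 2 * (∫ v in c..T, q v) - 2 * G T * (∫ v in c..T, q v * G v)
          + ∫ v in c..T, q v * G v ^ 2) := by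
  have hi {f : ℝ → ℝ} (hf : Continuous f) : IntervalIntegrable f MeasureTheory.volume c T :=
    hf.intervalIntegrable c T
  have h : ∀ v, p v * (G T - G v) - (1 / 2) * q v * (G T - G v) ^ 2
      = G T * p v - p v * G v
        - (1 / 2) * (G T ^ 2 * q v - 2 * G T * (q v * G v) + q v * G v ^ 2) :=
    fun v => by ring
  simp_rw [h]
  rw [integral_sub (hi (by fun_prop)) (hi (by fun_prop)),
    integral_sub (hi (by fun_prop)) (hi (by fun_prop)), integral_const_mul, integral_const_mul,
    integral_add (hi (by fun_prop)) (hi (by fun_prop)),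
    integral_sub (hi (by fun_prop)) (hi (by fun_prop)), integral_const_mul, integral_const_mul]

/-- The derivative in `T` of `∫ v in c..T, (p v * (G T - G v) - q v * (G T - G v) ^ 2 / 2)`. -/
theorem hasDerivAt_integral_mul_sub_sub_half_mul_sub_sq {p q g G : ℝ → ℝ} (hp : Continuous p)
    (hq : Continuous q) (hG : ∀ t, HasDerivAt G (g t) t) (c T : ℝ) :
    HasDerivAt (fun T => ∫ v in c..T, (p v * (G T - G v) - (1 / 2) * q v * (G T - G v) ^ 2))
      (g T * ((∫ v in c..T, p v) - G T * (∫ v in c..T, q v) + ∫ v in c..T, q v * G v)) T := by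
  have hGc : Continuous G := continuous_iff_continuousAt.2 fun t => (hG t).continuousAt
  simp_rw [integral_mul_sub_sub_half_mul_sub_sq hp hq hGc]
  have hP := hp.integral_hasStrictDerivAt c T |>.hasDerivAt
  have hPG := (hp.mul hGc).integral_hasStrictDerivAt c T |>.hasDerivAt
  have hQ := hq.integral_hasStrictDerivAt c T |>.hasDerivAt
  have hQG := (hq.mul hGc).integral_hasStrictDerivAt c T |>.hasDerivAt
  have hQG2 := (hq.mul (hGc.pow 2)).integral_hasStrictDerivAt c T |>.hasDerivAt
  refine ((((hG T).mul hP).sub hPG).sub ((((((hG T).pow 2).mul hQ).sub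
    (((hG T).const_mul 2).mul hQG)).add hQG2).const_mul (1 / 2))).congr_deriv ?_
  simp
  ring

/-- The Hull-White calibration ODE for the deterministic drift `a`:
if `Λ₀(t) = y(t) − r₀·Γ(0,t)` for all `t`, then
`a'(t)e^{2κ(t)} + 2a(t)b(t)e^{2κ(t)} − e^{2κ(t)}σ(t)²
  = d/dt [ e^{κ(t)} d/dt ( e^{κ(t)} d/dt ( y(t) − r₀ G(t) ) ) ]`. -/
theorem hull_white_calibration_ode
    (a b σ : ℝ → ℝ) (hb : Continuous b) (hσ : Continuous σ) (ha : ContDiff ℝ 1 a)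
    (κ G Λ₀ : ℝ → ℝ)
    (hκ : ∀ t, κ t = ∫ s in (0:ℝ)..t, b s)
    (hG : ∀ t, G t = ∫ s in (0:ℝ)..t, Real.exp (-κ s))
    (hΛ : ∀ T, Λ₀ T = ∫ v in (0:ℝ)..T,
      (Real.exp (κ v) * a v * (∫ z in v..T, Real.exp (-κ z))
        - (1/2) * Real.exp (2 * κ v) * σ v ^ 2 * (∫ z in v..T, Real.exp (-κ z)) ^ 2))
    (r₀ : ℝ) (y : ℝ → ℝ)
    (hy : ∀ t, Λ₀ t = y t - r₀ * G t) :
    ∀ t, deriv a t * Real.exp (2 * κ t) + 2 * a t * b t * Real.exp (2 * κ t)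
        - Real.exp (2 * κ t) * σ t ^ 2
      = deriv (fun t₁ => Real.exp (κ t₁)
          * deriv (fun t₂ => Real.exp (κ t₂)
            * deriv (fun t₃ => y t₃ - r₀ * G t₃) t₂) t₁) t := by
  have hκd (t : ℝ) : HasDerivAt κ (b t) t := by
    rw [funext hκ]
    exact (hb.integral_hasStrictDerivAt 0 t).hasDerivAt
  have hκc : Continuous κ := continuous_iff_continuousAt.2 fun t => (hκd t).continuousAt
  have hgc : Continuous fun s => Real.exp (-κ s) := by fun_prop
  have hGd (t : ℝ) : HasDerivAt G (Real.exp (-κ t)) t := by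
    rw [funext hG]
    exact (hgc.integral_hasStrictDerivAt 0 t).hasDerivAt
  have hGc : Continuous G := continuous_iff_continuousAt.2 fun t => (hGd t).continuousAt
  have hac : Continuous a := ha.continuous
  have hpc : Continuous fun v => Real.exp (κ v) * a v := by fun_prop
  have hqc : Continuous fun v => Real.exp (2 * κ v) * σ v ^ 2 := by fun_prop
  have hsub (v T : ℝ) : ∫ z in v..T, Real.exp (-κ z) = G T - G v := by
    rw [hG, hG, intervalIntegral.integral_interval_sub_left] <;>
      exact hgc.intervalIntegrable _ _
  have hcancel (t : ℝ) : Real.exp (κ t) * Real.exp (-κ t) = 1 := by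
    rw [← Real.exp_add, add_neg_cancel, Real.exp_zero]
  have hΛfun : (fun t => y t - r₀ * G t) = fun T => ∫ v in (0:ℝ)..T,
      (Real.exp (κ v) * a v * (G T - G v)
        - (1 / 2) * (Real.exp (2 * κ v) * σ v ^ 2) * (G T - G v) ^ 2) := by
    funext T
    simp_rw [← hy, hΛ, hsub, mul_assoc]
  have hfirst : (fun t => Real.exp (κ t) * deriv (fun t => y t - r₀ * G t) t) = fun t =>
      (∫ v in (0:ℝ)..t, Real.exp (κ v) * a v)
        - G t * (∫ v in (0:ℝ)..t, Real.exp (2 * κ v) * σ v ^ 2)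
        + ∫ v in (0:ℝ)..t, Real.exp (2 * κ v) * σ v ^ 2 * G v := by
    funext t
    rw [hΛfun, (hasDerivAt_integral_mul_sub_sub_half_mul_sub_sq hpc hqc hGd 0 t).deriv,
      ← mul_assoc, hcancel, one_mul]
  have hQ (t : ℝ) := (hqc.integral_hasStrictDerivAt 0 t).hasDerivAt
  have hsecond : (fun t₁ => Real.exp (κ t₁) * deriv (fun t₂ => Real.exp (κ t₂)
      * deriv (fun t₃ => y t₃ - r₀ * G t₃) t₂) t₁) = fun t =>
      Real.exp (2 * κ t) * a t - ∫ v in (0:ℝ)..t, Real.exp (2 * κ v) * σ v ^ 2 := by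
    funext t
    have hd := (((hpc.integral_hasStrictDerivAt 0 t).hasDerivAt.sub ((hGd t).mul (hQ t))).add
      ((hqc.mul hGc).integral_hasStrictDerivAt 0 t).hasDerivAt).deriv
    rw [hfirst]
    refine (congrArg (Real.exp (κ t) * ·) hd).trans ?_
    have hexp : Real.exp (2 * κ t) = Real.exp (κ t) * Real.exp (κ t) := by
      rw [← Real.exp_add, two_mul]
    simp only [Pi.mul_apply]
    linear_combination (-a t) * hexp
      - (∫ v in (0:ℝ)..t, Real.exp (2 * κ v) * σ v ^ 2) * hcancel t
  intro t
  have had : HasDerivAt a (deriv a t) t := (ha.differentiable one_ne_zero t).hasDerivAt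
  rw [hsecond]
  refine Eq.symm (((((hκd t).const_mul 2).exp.mul had).sub (hQ t)).deriv.trans ?_)
  ring
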